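/- arXiv:2406.19605 — 9 statements merged into one kernel-verified Lean document; each statement's English description precedes it below -/
import Mathlib

section
/- (Strong duality of the augmented Lagrangian dual.) Suppose the integer program is feasible with bounded optimal value f^IP, its linear programming relaxation has finite optimal value f^LP attained together with an optimal nonnegative dual vector for the constraints Ax ≤ b, and there is a minimum achievable non-zero slack: a number δ > 0 such that for every row index i ∈ {1,…,m} and every x ∈ X with aᵢᵀx > bᵢ one has δ ≤ (aᵢᵀx − bᵢ)². Then there exists a finite ρ* ∈ (0, +∞) such that sup_{λ ∈ ℝ₊ᵐ} d(λ, ρ*) = f^IP. -/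
open Matrix

/-- componentwise positive part -/
noncomputable def posv {k : ℕ} (v : Fin k → ℝ) : Fin k → ℝ := fun i => max (v i) 0

/-- The augmented Lagrangian
`L(x,λ,ρ) = cᵀx + λᵀ(Ax − b) + (ρ/2)‖(Ax − b)₊‖²`. -/
noncomputable def aL {m n : ℕ} (A : Matrix (Fin m) (Fin n) ℝ) (b : Fin m → ℝ)
    (c : Fin n → ℝ) (x : Fin n → ℝ) (lam : Fin m → ℝ) (ρ : ℝ) : ℝ :=
  c ⬝ᵥ x + lam ⬝ᵥ (A.mulVec x - b) + (ρ / 2) * ∑ i, (posv (A.mulVec x - b)) i ^ 2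

/-- The augmented Lagrangian dual function `d(λ,ρ) = min_{x ∈ X} L(x,λ,ρ)`. -/
noncomputable def dualFn {m n : ℕ} (A : Matrix (Fin m) (Fin n) ℝ) (b : Fin m → ℝ)
    (c : Fin n → ℝ) (X : Set (Fin n → ℝ)) (lam : Fin m → ℝ) (ρ : ℝ) : ℝ :=
  sInf ((fun x => aL A b c x lam ρ) '' X)

lemma sum_posv_sq_eq_zero {k : ℕ} {v : Fin k → ℝ} (hv : ∀ i, v i ≤ 0) :
    ∑ i, posv v i ^ 2 = 0 :=
  Finset.sum_eq_zero fun i _ => by simp [posv, max_eq_right (hv i)]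

lemma sq_le_sum_posv_sq {k : ℕ} {v : Fin k → ℝ} {i : Fin k} (hi : 0 ≤ v i) :
    v i ^ 2 ≤ ∑ j, posv v j ^ 2 := by
  have h := Finset.single_le_sum (f := fun j => posv v j ^ 2)
    (fun j _ => sq_nonneg _) (Finset.mem_univ i)
  simpa [posv, max_eq_left hi] using h

/-- Weak duality: at a feasible point the augmented Lagrangian is at most the objective. -/
lemma dualFn_le_of_feasible {m n : ℕ} {A : Matrix (Fin m) (Fin n) ℝ} {b : Fin m → ℝ}
    {c : Fin n → ℝ} {X : Set (Fin n → ℝ)} (hX : X.Finite) {x : Fin n → ℝ} (hx : x ∈ X)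
    (hfeas : ∀ i, A.mulVec x i ≤ b i) {lam : Fin m → ℝ} (hlam : ∀ i, 0 ≤ lam i) (ρ : ℝ) :
    dualFn A b c X lam ρ ≤ c ⬝ᵥ x := by
  have hv : ∀ i, (A.mulVec x - b) i ≤ 0 := fun i => sub_nonpos.2 (hfeas i)
  have hpair : lam ⬝ᵥ (A.mulVec x - b) ≤ 0 :=
    Finset.sum_nonpos fun i _ => mul_nonpos_of_nonneg_of_nonpos (hlam i) (hv i)
  calc dualFn A b c X lam ρ ≤ aL A b c x lam ρ :=
        csInf_le (hX.image _).bddBelow (Set.mem_image_of_mem _ hx)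
    _ ≤ c ⬝ᵥ x := by
        rw [aL, sum_posv_sq_eq_zero hv]
        linarith

/-- strong duality of the augmented Lagrangian dual.
If the IP is feasible with (attained, bounded) optimal value `f^IP`, the LP relaxation
has finite optimal value `f^LP` together with a nonnegative dual vector `λ^LP` for
`Ax ≤ b` (so that `cᵀx + (λ^LP)ᵀ(Ax − b) ≥ f^LP` for all `x ∈ X`), and there is a
minimum achievable non-zero slack `δ > 0`, then there exists a finite `ρ* ∈ (0,∞)` with
`sup_{λ ∈ ℝ₊ᵐ} d(λ,ρ*) = f^IP`. -/
theorem strong_duality {m n : ℕ} (A : Matrix (Fin m) (Fin n) ℝ) (b : Fin m → ℝ)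
    (c : Fin n → ℝ) (X : Set (Fin n → ℝ))
    (hXfin : X.Finite) (hXne : X.Nonempty)
    (hXbin : ∀ x ∈ X, ∀ i, x i = 0 ∨ x i = 1)
    (fIP : ℝ)
    (hfIP : IsLeast {r : ℝ | ∃ x ∈ X, (∀ i, A.mulVec x i ≤ b i) ∧ r = c ⬝ᵥ x} fIP)
    (fLP : ℝ) (lamLP : Fin m → ℝ) (hlamLP : ∀ i, 0 ≤ lamLP i)
    (hLPdual : ∀ x ∈ X, fLP ≤ c ⬝ᵥ x + lamLP ⬝ᵥ (A.mulVec x - b))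
    (δ : ℝ) (hδ : 0 < δ)
    (hslack : ∀ i : Fin m, ∀ x ∈ X, b i < A.mulVec x i → δ ≤ (A.mulVec x i - b i) ^ 2) :
    ∃ ρstar : ℝ, 0 < ρstar ∧
      sSup {r : ℝ | ∃ lam : Fin m → ℝ, (∀ i, 0 ≤ lam i) ∧ r = dualFn A b c X lam ρstar}
        = fIP := by
  obtain ⟨⟨x₀, hx₀, hfeas₀, hval₀⟩, hmin⟩ := hfIP
  obtain ⟨M, hM⟩ := (hXfin.image fun x => c ⬝ᵥ x).bddBelow
  -- With zero multiplier, this penalty lifts every infeasible point above the optimal value.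
  set ρ : ℝ := 2 * (|fIP - M| + 1) / δ with hρ_def
  have hρ : 0 < ρ := by positivity
  have hρδ : ρ / 2 * δ = |fIP - M| + 1 := by
    rw [hρ_def]
    field_simp
  have hupper : ∀ lam : Fin m → ℝ, (∀ i, 0 ≤ lam i) → dualFn A b c X lam ρ ≤ fIP :=
    fun lam hlam => hval₀ ▸ dualFn_le_of_feasible hXfin hx₀ hfeas₀ hlam ρ
  have hlower : fIP ≤ dualFn A b c X 0 ρ := by
    refine le_csInf (hXne.image _) ?_
    rintro _ ⟨x, hx, rfl⟩
    simp only [aL, zero_dotProduct, add_zero]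
    by_cases hfeas : ∀ i, A.mulVec x i ≤ b i
    · have hle : fIP ≤ c ⬝ᵥ x := hmin ⟨x, hx, hfeas, rfl⟩
      have : 0 ≤ ρ / 2 * ∑ i, posv (A.mulVec x - b) i ^ 2 :=
        mul_nonneg (by positivity) (Finset.sum_nonneg fun i _ => sq_nonneg _)
      linarith
    · push Not at hfeas
      obtain ⟨i, hi⟩ := hfeas
      have hsum : δ ≤ ∑ j, posv (A.mulVec x - b) j ^ 2 :=
        (hslack i x hx hi).trans
          (sq_le_sum_posv_sq (v := A.mulVec x - b) (i := i) (sub_nonneg.2 hi.le))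
      have hpen := mul_le_mul_of_nonneg_left hsum (by positivity : 0 ≤ ρ / 2)
      have hMx : M ≤ c ⬝ᵥ x := hM (Set.mem_image_of_mem _ hx)
      linarith [le_abs_self (fIP - M)]
  refine ⟨ρ, hρ, IsGreatest.csSup_eq ⟨⟨0, fun _ => le_rfl, ?_⟩, ?_⟩⟩
  · exact le_antisymm hlower (hupper 0 fun _ => le_rfl)
  · rintro _ ⟨lam, hlam, rfl⟩
    exact hupper lam hlam
end

section
/- (Penalty lower bound at infeasible points.) Let x⁰ ∈ X satisfy Ax⁰ ≤ b, let f^LP ∈ ℝ with f^LP ≤ cᵀx⁰, and let λ* ∈ ℝ₊ᵐ satisfy cᵀx + (λ*)ᵀ(Ax − b) ≥ f^LP for all x ∈ X. Suppose δ > 0 satisfies δ ≤ (aᵢᵀx − bᵢ)² for every i and every x ∈ X with aᵢᵀx > bᵢ, and set ρ* = 2(cᵀx⁰ − f^LP)/δ. Then for every x ∈ X violating at least one constraint (i.e., aᵢᵀx > bᵢ for some i), one has L(x, λ*, ρ*) ≥ cᵀx⁰ ≥ f^IP. -/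
open Matrix

/-- penalty lower bound at infeasible points.
Let `x⁰ ∈ X` be feasible, `f^LP ≤ cᵀx⁰`, let `λ* ≥ 0` satisfy
`cᵀx + (λ*)ᵀ(Ax − b) ≥ f^LP` for all `x ∈ X`, let `δ > 0` be a minimum achievable
non-zero slack and `ρ* = 2(cᵀx⁰ − f^LP)/δ`.  Then every `x ∈ X` violating at least one
constraint satisfies `L(x,λ*,ρ*) ≥ cᵀx⁰ ≥ f^IP`. -/
theorem penalty_lower_bound {m n : ℕ} (A : Matrix (Fin m) (Fin n) ℝ) (b : Fin m → ℝ)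
    (c : Fin n → ℝ) (X : Set (Fin n → ℝ))
    (hXfin : X.Finite) (hXne : X.Nonempty)
    (hXbin : ∀ x ∈ X, ∀ i, x i = 0 ∨ x i = 1)
    (fIP : ℝ)
    (hfIP : IsLeast {r : ℝ | ∃ x ∈ X, (∀ i, A.mulVec x i ≤ b i) ∧ r = c ⬝ᵥ x} fIP)
    (x0 : Fin n → ℝ) (hx0X : x0 ∈ X) (hx0feas : ∀ i, A.mulVec x0 i ≤ b i)
    (fLP : ℝ) (hfLPle : fLP ≤ c ⬝ᵥ x0)
    (lamStar : Fin m → ℝ) (hlamStar : ∀ i, 0 ≤ lamStar i)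
    (hLPdual : ∀ x ∈ X, fLP ≤ c ⬝ᵥ x + lamStar ⬝ᵥ (A.mulVec x - b))
    (δ : ℝ) (hδ : 0 < δ)
    (hslack : ∀ i : Fin m, ∀ x ∈ X, b i < A.mulVec x i → δ ≤ (A.mulVec x i - b i) ^ 2)
    (ρstar : ℝ) (hρstar : ρstar = 2 * (c ⬝ᵥ x0 - fLP) / δ) :
    ∀ x ∈ X, (∃ i, b i < A.mulVec x i) →
      c ⬝ᵥ x0 ≤ aL A b c x lamStar ρstar ∧ fIP ≤ c ⬝ᵥ x0 := by
  rintro x hx ⟨i, hi⟩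
  refine ⟨?_, hfIP.2 ⟨x0, hx0X, hx0feas, rfl⟩⟩
  have hpos : posv (A.mulVec x - b) i = A.mulVec x i - b i :=
    max_eq_left (sub_nonneg.mpr hi.le)
  have hsum : δ ≤ ∑ j, (posv (A.mulVec x - b)) j ^ 2 := by
    calc δ ≤ posv (A.mulVec x - b) i ^ 2 := hpos ▸ hslack i x hx hi
      _ ≤ ∑ j, (posv (A.mulVec x - b)) j ^ 2 :=
        Finset.single_le_sum (f := fun j => posv (A.mulVec x - b) j ^ 2)
          (fun j _ => sq_nonneg _) (Finset.mem_univ i)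
  have hρ : 0 ≤ ρstar / 2 := by
    have := sub_nonneg.mpr hfLPle
    rw [hρstar]
    positivity
  have hgap : ρstar / 2 * δ = c ⬝ᵥ x0 - fLP := by
    rw [hρstar]
    field_simp
  have hpen := mul_le_mul_of_nonneg_left hsum hρ
  have hdual := hLPdual x hx
  unfold aL
  linarith
end

section
/- (Coordinatewise positive-part identity used to linearize the quadratic penalty.) Let y ∈ {0,1}ᵐ and let z ∈ ℝᵐ have nonnegative integer entries. Then ‖(y + z − 1)₊‖² = 2·yᵀ(z − (1/2)·1)₊ + ‖(z − 1)₊‖², where 1 denotes the all-ones vector in ℝᵐ. -/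
open Matrix

/-- coordinatewise positive-part identity used to linearize the quadratic
penalty.  If `y ∈ {0,1}ᵐ` and `z` has nonnegative integer entries, then
`‖(y + z − 1)₊‖² = 2·yᵀ(z − ½·1)₊ + ‖(z − 1)₊‖²`. -/
theorem positive_part_identity {m : ℕ} (y z : Fin m → ℝ)
    (hy : ∀ i, y i = 0 ∨ y i = 1)
    (hz : ∀ i, ∃ k : ℕ, z i = (k : ℝ)) :
    ∑ i, max (y i + z i - 1) 0 ^ 2
      = 2 * (y ⬝ᵥ fun i => max (z i - 1 / 2) 0) + ∑ i, max (z i - 1) 0 ^ 2 := by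
  rw [dotProduct, Finset.mul_sum, ← Finset.sum_add_distrib]
  refine Finset.sum_congr rfl fun i _ => ?_
  obtain ⟨k, hk⟩ := hz i
  rw [hk]
  rcases hy i with h | h <;> rw [h]
  · simp
  · rcases k with _ | k
    · norm_num
    · have hk₀ : (0 : ℝ) ≤ k := k.cast_nonneg
      push_cast
      rw [max_eq_left (by linarith), max_eq_left (by linarith), max_eq_left (by linarith)]
      ring
end

section
/- (Exact linearization of the augmented Lagrangian in one block.) Suppose every entry of A is 0 or 1 and b = 1 (the all-ones vector). Fix a block index j, fix binary vectors x_l ∈ {0,1}^{n_l} for all l ≠ j, and set z = Σ_{l≠j} A_l x_l. Then for every x_j ∈ {0,1}^{n_j} with A_j x_j ≤ 1 componentwise, L((x₁,…,x_{j−1}, x_j, x_{j+1},…,x_p), λ, ρ) = (c_j + A_jᵀλ + ρ·A_jᵀ(z − (1/2)·1)₊)ᵀ x_j + K, where K = Σ_{l≠j} c_lᵀx_l + λᵀ(z − 1) + (ρ/2)‖(z − 1)₊‖² does not depend on x_j. Hence minimizing L over such x_j reduces to minimizing the linear function with coefficient vector c_j + A_jᵀλ + ρ·A_jᵀ(z −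 (1/2)·1)₊. -/
open Matrix

/-- The augmented Lagrangian for a block-structured problem with `p` blocks:
`L(x,λ,ρ) = Σⱼ cⱼᵀxⱼ + λᵀ(Σⱼ Aⱼxⱼ − b) + (ρ/2)‖(Σⱼ Aⱼxⱼ − b)₊‖²`. -/
noncomputable def bL {m p : ℕ} {nn : Fin p → ℕ}
    (A : ∀ j, Matrix (Fin m) (Fin (nn j)) ℝ) (b : Fin m → ℝ)
    (c : ∀ j, Fin (nn j) → ℝ) (x : ∀ j, Fin (nn j) → ℝ)
    (lam : Fin m → ℝ) (ρ : ℝ) : ℝ :=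
  (∑ j, c j ⬝ᵥ x j) + lam ⬝ᵥ ((∑ j, (A j).mulVec (x j)) - b)
    + (ρ / 2) * ∑ i, max (((∑ j, (A j).mulVec (x j)) - b) i) 0 ^ 2

theorem exists_nat_cast_eq_sum {ι : Type*} (t : Finset ι) (f : ι → ℝ)
    (hf : ∀ a ∈ t, ∃ k : ℕ, f a = k) : ∃ k : ℕ, ∑ a ∈ t, f a = k := by
  obtain ⟨k, hk⟩ := sum_mem (S := AddMonoidHom.mrange (Nat.castAddMonoidHom ℝ)) (t := t) (f := f)
    fun a ha => (hf a ha).imp fun _ h => h.symm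
  exact ⟨k, hk.symm⟩

theorem exists_nat_cast_eq_mulVec {m n : Type*} [Fintype n] {M : Matrix m n ℝ} {v : n → ℝ}
    (hM : ∀ i s, M i s = 0 ∨ M i s = 1) (hv : ∀ s, v s = 0 ∨ v s = 1) (i : m) :
    ∃ k : ℕ, M.mulVec v i = k := by
  refine exists_nat_cast_eq_sum _ _ fun s _ => ?_
  rcases hM i s with h | h
  · exact ⟨0, by simp [h]⟩
  · rcases hv s with h' | h'
    · exact ⟨0, by simp [h']⟩
    · exact ⟨1, by simp [h, h']⟩

theorem sq_max_add_sub_one {z y : ℝ} (hz : ∃ k : ℕ, z = k) (hy : ∃ k : ℕ, y = k) (hy1 : y ≤ 1) :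
    max (z + y - 1) 0 ^ 2 = max (z - 1) 0 ^ 2 + 2 * (max (z - 1 / 2) 0 * y) := by
  obtain ⟨l, rfl⟩ := hy
  have hl : l ≤ 1 := by exact_mod_cast hy1
  interval_cases l
  · simp
  · obtain ⟨k, rfl⟩ := hz
    rcases k with _ | k
    · norm_num
    · have hk : (0 : ℝ) ≤ k := k.cast_nonneg
      push_cast
      rw [max_eq_left (by linarith), max_eq_left (by linarith), max_eq_left (by linarith)]
      ring

theorem sum_apply_update {ι M : Type*} [Fintype ι] [DecidableEq ι] [AddCommMonoid M]
    {β : ι → Type*} (F : ∀ i, β i → M) (x : ∀ i, β i) (i : ι) (y : β i) :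
    ∑ j, F j (Function.update x i y j) = F i y + ∑ j ∈ Finset.univ.erase i, F j (x j) := by
  rw [← Finset.add_sum_erase _ _ (Finset.mem_univ i), Function.update_self]
  congr 1
  refine Finset.sum_congr rfl fun j hj => ?_
  rw [Function.update_of_ne (Finset.ne_of_mem_erase hj)]

/-- exact linearization of the augmented Lagrangian in one block.
If every entry of `A` is `0` or `1` and `b = 1`, then fixing all blocks except `j₀`
(binary), setting `z = Σ_{l≠j₀} A_l x_l`, for every binary `x_{j₀}` with
`A_{j₀} x_{j₀} ≤ 1` we have
`L(x,λ,ρ) = (c_{j₀} + A_{j₀}ᵀλ + ρ·A_{j₀}ᵀ(z − ½·1)₊)ᵀ x_{j₀} + K`, where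
`K = Σ_{l≠j₀} c_lᵀx_l + λᵀ(z − 1) + (ρ/2)‖(z − 1)₊‖²` does not depend on `x_{j₀}`;
hence minimizing `L` over such `x_{j₀}` is equivalent to minimizing the linear function
with coefficient vector `c_{j₀} + A_{j₀}ᵀλ + ρ·A_{j₀}ᵀ(z − ½·1)₊`. -/
theorem block_linearization {m p : ℕ} {nn : Fin p → ℕ}
    (A : ∀ j, Matrix (Fin m) (Fin (nn j)) ℝ)
    (hA01 : ∀ j i s, A j i s = 0 ∨ A j i s = 1)
    (c : ∀ j, Fin (nn j) → ℝ)
    (lam : Fin m → ℝ) (hlam : ∀ i, 0 ≤ lam i) (ρ : ℝ) (hρ : 0 < ρ)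
    (j0 : Fin p) (x : ∀ j, Fin (nn j) → ℝ)
    (hxbin : ∀ j, j ≠ j0 → ∀ s, x j s = 0 ∨ x j s = 1)
    (z : Fin m → ℝ) (hz : z = ∑ l ∈ Finset.univ.erase j0, (A l).mulVec (x l))
    (K : ℝ)
    (hK : K = (∑ l ∈ Finset.univ.erase j0, c l ⬝ᵥ x l)
        + lam ⬝ᵥ (fun i => z i - 1)
        + (ρ / 2) * ∑ i, max (z i - 1) 0 ^ 2) :
    (∀ xj : Fin (nn j0) → ℝ, (∀ s, xj s = 0 ∨ xj s = 1) →
      (∀ i, (A j0).mulVec xj i ≤ 1) →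
      bL A (fun _ => 1) c (Function.update x j0 xj) lam ρ
        = (fun s => c j0 s + (A j0)ᵀ.mulVec lam s
              + ρ * (A j0)ᵀ.mulVec (fun i => max (z i - 1 / 2) 0) s) ⬝ᵥ xj + K)
    ∧ (∀ xj xj' : Fin (nn j0) → ℝ,
        (∀ s, xj s = 0 ∨ xj s = 1) → (∀ i, (A j0).mulVec xj i ≤ 1) →
        (∀ s, xj' s = 0 ∨ xj' s = 1) → (∀ i, (A j0).mulVec xj' i ≤ 1) →
        (bL A (fun _ => 1) c (Function.update x j0 xj) lam ρ
            ≤ bL A (fun _ => 1) c (Function.update x j0 xj') lam ρ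
          ↔ (fun s => c j0 s + (A j0)ᵀ.mulVec lam s
                + ρ * (A j0)ᵀ.mulVec (fun i => max (z i - 1 / 2) 0) s) ⬝ᵥ xj
              ≤ (fun s => c j0 s + (A j0)ᵀ.mulVec lam s
                + ρ * (A j0)ᵀ.mulVec (fun i => max (z i - 1 / 2) 0) s) ⬝ᵥ xj')) := by
  have key : ∀ xj : Fin (nn j0) → ℝ, (∀ s, xj s = 0 ∨ xj s = 1) →
      (∀ i, (A j0).mulVec xj i ≤ 1) →
      bL A (fun _ => 1) c (Function.update x j0 xj) lam ρ
        = (fun s => c j0 s + (A j0)ᵀ.mulVec lam s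
              + ρ * (A j0)ᵀ.mulVec (fun i => max (z i - 1 / 2) 0) s) ⬝ᵥ xj + K := by
    intro xj hbin hle
    have hzn : ∀ i, ∃ k : ℕ, z i = k := by
      intro i
      rw [hz, Finset.sum_apply]
      exact exists_nat_cast_eq_sum _ _ fun l hl =>
        exists_nat_cast_eq_mulVec (hA01 l) (hxbin l (Finset.ne_of_mem_erase hl)) i
    have hsq : ∑ i, max (((A j0).mulVec xj + z - fun _ => 1 : Fin m → ℝ) i) 0 ^ 2
        = ∑ i, max (z i - 1) 0 ^ 2
          + 2 * ((fun i => max (z i - 1 / 2) 0) ⬝ᵥ (A j0).mulVec xj) := by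
      rw [dotProduct, Finset.mul_sum, ← Finset.sum_add_distrib]
      refine Finset.sum_congr rfl fun i _ => ?_
      rw [← sq_max_add_sub_one (hzn i) (exists_nat_cast_eq_mulVec (hA01 j0) hbin i) (hle i),
        Pi.sub_apply, Pi.add_apply, add_comm (z i)]
    have hlin : (fun s => c j0 s + (A j0)ᵀ.mulVec lam s
          + ρ * (A j0)ᵀ.mulVec (fun i => max (z i - 1 / 2) 0) s) ⬝ᵥ xj
        = c j0 ⬝ᵥ xj + lam ⬝ᵥ (A j0).mulVec xj
          + ρ * ((fun i => max (z i - 1 / 2) 0) ⬝ᵥ (A j0).mulVec xj) := by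
      change (c j0 + (A j0)ᵀ.mulVec lam
        + ρ • (A j0)ᵀ.mulVec (fun i => max (z i - 1 / 2) 0)) ⬝ᵥ xj = _
      rw [add_dotProduct, add_dotProduct, smul_dotProduct, mulVec_transpose, mulVec_transpose,
        ← dotProduct_mulVec, ← dotProduct_mulVec, smul_eq_mul]
    have hlam_split : lam ⬝ᵥ ((A j0).mulVec xj + z - fun _ => 1)
        = lam ⬝ᵥ (A j0).mulVec xj + lam ⬝ᵥ (fun i => z i - 1) := by
      rw [add_sub_assoc, dotProduct_add]
      rfl
    rw [bL, sum_apply_update (fun j v => c j ⬝ᵥ v),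
      sum_apply_update (fun j v => (A j).mulVec v), ← hz, hsq, hlin, hlam_split, hK]
    ring
  refine ⟨key, fun xj xj' h1 h2 h3 h4 => ?_⟩
  rw [key xj h1 h2, key xj' h3 h4, add_le_add_iff_right]
end

section
/- (Feasible block minimizers under the structural assumption.) Suppose every entry of A is 0 or 1 and b = 1. Fix a block index j and binary vectors x_l ∈ {0,1}^{n_l} for all l ≠ j, and assume: (i) the cost vector c_j has at most one nonzero entry, and (ii) every x_j ∈ {0,1}^{n_j} with A_j x_j ≤ 1 componentwise belongs to X_j. Then the minimum of the map x_j ↦ L((x₁,…,x_j,…,x_p), λ, ρ) over X_j is attained at some x_j* satisfying A_j x_j* ≤ 1; equivalently, min over X_j equals min over {x_j ∈ X_j : A_j x_j ≤ 1}. -/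
open Matrix

/-- For nonnegative multipliers and penalty, the augmented Lagrangian is monotone in the pair
(cost of a block, constraint activity of that block). -/
theorem bL_update_le_bL_update {m p : ℕ} {nn : Fin p → ℕ}
    (A : ∀ j, Matrix (Fin m) (Fin (nn j)) ℝ) (b : Fin m → ℝ)
    (c : ∀ j, Fin (nn j) → ℝ) (x : ∀ j, Fin (nn j) → ℝ)
    {lam : Fin m → ℝ} (hlam : ∀ i, 0 ≤ lam i) {ρ : ℝ} (hρ : 0 ≤ ρ)
    (j0 : Fin p) {y z : Fin (nn j0) → ℝ} (hc : c j0 ⬝ᵥ y ≤ c j0 ⬝ᵥ z)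
    (hA : (A j0).mulVec y ≤ (A j0).mulVec z) :
    bL A b c (Function.update x j0 y) lam ρ ≤ bL A b c (Function.update x j0 z) lam ρ := by
  have hcost : ∑ j, c j ⬝ᵥ Function.update x j0 y j ≤ ∑ j, c j ⬝ᵥ Function.update x j0 z j := by
    refine Finset.sum_le_sum fun j _ => ?_
    rcases eq_or_ne j j0 with rfl | h
    · simpa using hc
    · simp [h]
  have hact : (∑ j, (A j).mulVec (Function.update x j0 y j)) - b
      ≤ (∑ j, (A j).mulVec (Function.update x j0 z j)) - b := by
    refine sub_le_sub_right (Finset.sum_le_sum fun j _ => ?_) _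
    rcases eq_or_ne j j0 with rfl | h
    · simpa using hA
    · simp [h]
  unfold bL
  refine add_le_add (add_le_add hcost (dotProduct_le_dotProduct_of_nonneg_left hact hlam)) ?_
  refine mul_le_mul_of_nonneg_left (Finset.sum_le_sum fun i _ => ?_) (by positivity)
  exact pow_le_pow_left₀ (le_max_right _ _) (max_le_max_right _ (hact i)) 2

/-- feasible block minimizers under the structural assumption.
Suppose every entry of `A` is `0` or `1` and `b = 1`.  Fix a block `j₀` and points
`x_l ∈ X_l` for `l ≠ j₀`, and assume (i) `c_{j₀}` has at most one nonzero entry and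
(ii) every binary `x_{j₀}` with `A_{j₀} x_{j₀} ≤ 1` belongs to `X_{j₀}`.  Then the
minimum of `x_{j₀} ↦ L(x,λ,ρ)` over `X_{j₀}` is attained at some `x_{j₀}*` with
`A_{j₀} x_{j₀}* ≤ 1`. -/
theorem feasible_block_minimizer {m p : ℕ} {nn : Fin p → ℕ}
    (A : ∀ j, Matrix (Fin m) (Fin (nn j)) ℝ)
    (hA01 : ∀ j i s, A j i s = 0 ∨ A j i s = 1)
    (c : ∀ j, Fin (nn j) → ℝ)
    (X : ∀ j, Set (Fin (nn j) → ℝ)) (hXne : ∀ j, (X j).Nonempty)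
    (hXbin : ∀ j, ∀ y ∈ X j, ∀ s, y s = 0 ∨ y s = 1)
    (lam : Fin m → ℝ) (hlam : ∀ i, 0 ≤ lam i) (ρ : ℝ) (hρ : 0 < ρ)
    (j0 : Fin p) (x : ∀ j, Fin (nn j) → ℝ) (hx : ∀ j, j ≠ j0 → x j ∈ X j)
    (hc : ∀ s t : Fin (nn j0), c j0 s ≠ 0 → c j0 t ≠ 0 → s = t)
    (hbig : ∀ xj : Fin (nn j0) → ℝ, (∀ s, xj s = 0 ∨ xj s = 1) →
        (∀ i, (A j0).mulVec xj i ≤ 1) → xj ∈ X j0) :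
    ∃ xjstar ∈ X j0, (∀ i, (A j0).mulVec xjstar i ≤ 1) ∧
      ∀ xj ∈ X j0,
        bL A (fun _ => 1) c (Function.update x j0 xjstar) lam ρ
          ≤ bL A (fun _ => 1) c (Function.update x j0 xj) lam ρ := by
  have hA0 : ∀ i s, 0 ≤ A j0 i s := fun i s => by rcases hA01 j0 i s with h | h <;> simp [h]
  have hmono : ∀ y z : Fin (nn j0) → ℝ, y ≤ z → (A j0).mulVec y ≤ (A j0).mulVec z :=
    fun y z hyz i => dotProduct_le_dotProduct_of_nonneg_left hyz (hA0 i)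
  have hX0 : ∀ y ∈ X j0, 0 ≤ y := fun y hy s => by
    rcases hXbin j0 y hy s with h | h <;> simp [h]
  have hfeas0 : ∀ i, (A j0).mulVec 0 i ≤ 1 := by simp
  have hmem0 : (0 : Fin (nn j0) → ℝ) ∈ X j0 := hbig 0 (by simp) hfeas0
  by_cases hcz : c j0 = 0
  · exact ⟨0, hmem0, hfeas0, fun y hy => bL_update_le_bL_update A _ c x hlam hρ.le j0
      (by simp [hcz]) (hmono _ _ (hX0 y hy))⟩
  obtain ⟨s, hs⟩ := Function.ne_iff.mp hcz
  have hfeas1 : ∀ i, (A j0).mulVec (Pi.single s 1) i ≤ 1 := fun i => by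
    rcases hA01 j0 i s with h | h <;> simp [h]
  have hmem1 : (Pi.single s 1 : Fin (nn j0) → ℝ) ∈ X j0 := by
    refine hbig _ (fun t => ?_) hfeas1
    rcases eq_or_ne t s with rfl | h
    · simp
    · simp [h]
  have hdom : ∀ y ∈ X j0, bL A (fun _ => 1) c (Function.update x j0 (Pi.single s (y s))) lam ρ
      ≤ bL A (fun _ => 1) c (Function.update x j0 y) lam ρ := fun y hy => by
    refine bL_update_le_bL_update A _ c x hlam hρ.le j0 (le_of_eq ?_) (hmono _ _ fun t => ?_)
    · rw [dotProduct_single]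
      refine Eq.symm (Fintype.sum_eq_single s fun t hts => ?_)
      have hct : c j0 t = 0 := by_contra fun h => hts (hc t s h hs)
      simp [hct]
    · rcases eq_or_ne t s with rfl | h
      · simp
      · simpa [h] using hX0 y hy t
  rcases le_total (bL A (fun _ => 1) c (Function.update x j0 0) lam ρ)
    (bL A (fun _ => 1) c (Function.update x j0 (Pi.single s 1)) lam ρ) with hle | hle
  · refine ⟨0, hmem0, hfeas0, fun y hy => le_trans ?_ (hdom y hy)⟩
    rcases hXbin j0 y hy s with h | h
    · simp [h]
    · rwa [h]
  · refine ⟨Pi.single s 1, hmem1, hfeas1, fun y hy => le_trans ?_ (hdom y hy)⟩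
    rcases hXbin j0 y hy s with h | h
    · rwa [h, Pi.single_zero]
    · rw [h]
end

section
/- (Sufficient decrease of one Gauss–Seidel sweep of the proximal-linear BCD method.) Let λ ∈ ℝ₊ᵐ, ρ > 0, κ = ρ‖A‖₂², and τ > 0. Let x^t ∈ X, and for j = 1,…,p define intermediate points x^t(j) = (x₁^{t+1},…,x_{j−1}^{t+1}, x_j^t, x_{j+1}^t,…,x_p^t), block gradients g_j(x^t) = ∇_{x_j} L(x^t(j), λ, ρ), and updates x_j^{t+1} ∈ argmin_{x_j ∈ X_j} { ⟨x_j − x_j^t, g_j(x^t)⟩ + (1/2τ)‖x_j − x_j^t‖² }. Then (1/(2τ) − κ/2)·‖x^{t+1} − x^t‖² ≤ L(x^t, λ, ρ) − L(x^{t+1}, λ, ρ), where x^{t+1} = (x₁^{t+1};…;x_p^{t+1}). In particular, if 0 < τ < 1/(2κ), then (κ/2)·‖x^{t+1} − x^t‖² ≤ L(x^t, λ, ρ) − L(x^{t+1}, λ, ρ). -/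
open Matrix

/-- The spectral (operator 2-) norm of a real matrix. -/
noncomputable def specNorm {α β : Type*} [Fintype α] [Fintype β] [DecidableEq β]
    (A : Matrix α β ℝ) : ℝ :=
  ‖LinearMap.toContinuousLinearMap (Matrix.toEuclideanLin A)‖

/-- The full matrix `A = (A₁ … A_p)` obtained by concatenating the blocks. -/
noncomputable def Atot {m p : ℕ} {nn : Fin p → ℕ}
    (A : ∀ j, Matrix (Fin m) (Fin (nn j)) ℝ) :
    Matrix (Fin m) ((j : Fin p) × Fin (nn j)) ℝ :=
  Matrix.of fun i js => A js.1 i js.2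

/-- Changing one block changes a block-separable sum by the change of that block's term. -/
theorem Finset.sum_apply_update_sub {ι M : Type*} [Fintype ι] [DecidableEq ι] [AddCommGroup M]
    {V : ι → Type*} (F : ∀ l, V l → M) (x : ∀ l, V l) (j : ι) (y : V j) :
    ∑ l, F l (Function.update x j y l) = ∑ l, F l (x l) + (F j y - F j (x j)) := by
  rw [← sub_eq_iff_eq_add', ← Finset.sum_sub_distrib, Finset.sum_eq_single j]
  · simp
  · intro l _ hl
    simp [Function.update_of_ne hl]
  · simp

theorem max_zero_sq_add_le (a h : ℝ) :
    max (a + h) 0 ^ 2 ≤ max a 0 ^ 2 + 2 * (h * max a 0) + h ^ 2 := by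
  rcases max_cases (a + h) 0 with ⟨e, _⟩ | ⟨e, _⟩ <;> rcases max_cases a 0 with ⟨e', _⟩ | ⟨e', _⟩ <;>
    rw [e, e'] <;> nlinarith [sq_nonneg (a + h)]

/-- The quadratic upper bound for the augmented Lagrangian along a single block. -/
theorem bL_update_le {m p : ℕ} {nn : Fin p → ℕ}
    (A : ∀ j, Matrix (Fin m) (Fin (nn j)) ℝ) (b : Fin m → ℝ)
    (c : ∀ j, Fin (nn j) → ℝ) (lam : Fin m → ℝ) {ρ : ℝ} (hρ : 0 ≤ ρ)
    (x : ∀ j, Fin (nn j) → ℝ) (j : Fin p) (y : Fin (nn j) → ℝ) :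
    bL A b c (Function.update x j y) lam ρ ≤ bL A b c x lam ρ
      + (y - x j) ⬝ᵥ (c j + (A j)ᵀ *ᵥ lam + ρ • (A j)ᵀ *ᵥ posv ((∑ l, A l *ᵥ x l) - b))
      + ρ / 2 * ∑ i, (A j *ᵥ (y - x j)) i ^ 2 := by
  have hc := Finset.sum_apply_update_sub (fun l v => c l ⬝ᵥ v) x j y
  have hA := Finset.sum_apply_update_sub (fun l v => A l *ᵥ v) x j y
  simp only [← dotProduct_sub, ← mulVec_sub] at hc hA
  have htr (v : Fin m → ℝ) : (y - x j) ⬝ᵥ (A j)ᵀ *ᵥ v = (A j *ᵥ (y - x j)) ⬝ᵥ v := by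
    rw [mulVec_transpose, dotProduct_comm, ← dotProduct_mulVec, dotProduct_comm]
  unfold bL
  rw [hc, hA, add_sub_right_comm, dotProduct_add, dotProduct_add, dotProduct_add, dotProduct_smul,
    htr, htr, dotProduct_comm (y - x j) (c j), dotProduct_comm (A j *ᵥ (y - x j)) lam]
  set r := (∑ l, A l *ᵥ x l) - b
  set h := A j *ᵥ (y - x j)
  have key : ∑ i, max ((r + h) i) 0 ^ 2
      ≤ ∑ i, max (r i) 0 ^ 2 + 2 * (h ⬝ᵥ posv r) + ∑ i, h i ^ 2 := by
    rw [dotProduct, Finset.mul_sum, ← Finset.sum_add_distrib, ← Finset.sum_add_distrib]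
    exact Finset.sum_le_sum fun i _ => max_zero_sq_add_le (r i) (h i)
  have := mul_le_mul_of_nonneg_left key (div_nonneg hρ zero_le_two)
  simp only [smul_eq_mul]
  linarith

theorem sum_mulVec_sq_le_specNorm {α β : Type*} [Fintype α] [Fintype β] [DecidableEq β]
    (M : Matrix α β ℝ) (v : β → ℝ) :
    ∑ i, (M *ᵥ v) i ^ 2 ≤ specNorm M ^ 2 * ∑ s, v s ^ 2 := by
  have h := (LinearMap.toContinuousLinearMap (Matrix.toEuclideanLin M)).le_opNorm (WithLp.toLp 2 v)
  have h2 := pow_le_pow_left₀ (norm_nonneg _) h 2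
  rw [mul_pow, EuclideanSpace.real_norm_sq_eq, EuclideanSpace.real_norm_sq_eq] at h2
  simpa [specNorm] using h2

/-- The spectral norm of a block is at most that of the full matrix. -/
theorem sum_block_mulVec_sq_le {m p : ℕ} {nn : Fin p → ℕ}
    (A : ∀ j, Matrix (Fin m) (Fin (nn j)) ℝ) (j : Fin p) (v : Fin (nn j) → ℝ) :
    ∑ i, (A j *ᵥ v) i ^ 2 ≤ specNorm (Atot A) ^ 2 * ∑ s, v s ^ 2 := by
  let x : ∀ l, Fin (nn l) → ℝ := Function.update 0 j v
  have hx := sum_mulVec_sq_le_specNorm (Atot A) fun q => x q.1 q.2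
  have h1 : Atot A *ᵥ (fun q => x q.1 q.2) = A j *ᵥ v := by
    have hs := Finset.sum_apply_update_sub (fun l w => A l *ᵥ w) 0 j v
    ext i
    have hi := congrFun hs i
    simpa [mulVec, dotProduct, Atot, Fintype.sum_sigma, Finset.sum_apply, x] using hi
  have h2 : ∑ q : (l : Fin p) × Fin (nn l), x q.1 q.2 ^ 2 = ∑ s, v s ^ 2 := by
    have hs := Finset.sum_apply_update_sub (fun l (w : Fin (nn l) → ℝ) => ∑ s, w s ^ 2) 0 j v
    rw [Fintype.sum_sigma]
    simpa [x] using hs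
  rwa [h1, h2] at hx

/-- sufficient decrease of one Gauss–Seidel sweep of the proximal-linear
BCD method.  With `κ = ρ‖A‖₂²` and step size `τ > 0`, if each block is updated by
`x_j^{t+1} ∈ argmin_{x_j ∈ X_j} ⟨x_j − x_j^t, g_j(x^t)⟩ + (1/2τ)‖x_j − x_j^t‖²`, where
`g_j(x^t) = ∇_{x_j} L(x^t(j),λ,ρ)` and `x^t(j)` takes the new values on blocks `l < j`,
then `(1/(2τ) − κ/2)‖x^{t+1} − x^t‖² ≤ L(x^t,λ,ρ) − L(x^{t+1},λ,ρ)`; in particular, if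
`τ < 1/(2κ)` then `(κ/2)‖x^{t+1} − x^t‖² ≤ L(x^t,λ,ρ) − L(x^{t+1},λ,ρ)`. -/
theorem bcd_sufficient_decrease {m p : ℕ} {nn : Fin p → ℕ}
    (A : ∀ j, Matrix (Fin m) (Fin (nn j)) ℝ) (b : Fin m → ℝ)
    (c : ∀ j, Fin (nn j) → ℝ)
    (X : ∀ j, Set (Fin (nn j) → ℝ)) (hXne : ∀ j, (X j).Nonempty)
    (hXbin : ∀ j, ∀ y ∈ X j, ∀ s, y s = 0 ∨ y s = 1)
    (lam : Fin m → ℝ) (hlam : ∀ i, 0 ≤ lam i) (ρ : ℝ) (hρ : 0 < ρ)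
    (κ : ℝ) (hκ : κ = ρ * specNorm (Atot A) ^ 2)
    (τ : ℝ) (hτ : 0 < τ)
    (xt xt1 : ∀ j, Fin (nn j) → ℝ) (hxt : ∀ j, xt j ∈ X j)
    (g : ∀ j, Fin (nn j) → ℝ)
    (hg : ∀ j, g j = fun s => c j s + (A j)ᵀ.mulVec lam s
        + ρ * (A j)ᵀ.mulVec
            (posv ((∑ l, (A l).mulVec (if l < j then xt1 l else xt l)) - b)) s)
    (hupd : ∀ j, xt1 j ∈ X j ∧ ∀ y ∈ X j,
        (fun s => xt1 j s - xt j s) ⬝ᵥ g j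
            + (1 / (2 * τ)) * ∑ s, (xt1 j s - xt j s) ^ 2
          ≤ (fun s => y s - xt j s) ⬝ᵥ g j
            + (1 / (2 * τ)) * ∑ s, (y s - xt j s) ^ 2) :
    ((1 / (2 * τ) - κ / 2) * ∑ j, ∑ s, (xt1 j s - xt j s) ^ 2
        ≤ bL A b c xt lam ρ - bL A b c xt1 lam ρ)
    ∧ (τ < 1 / (2 * κ) →
        (κ / 2) * ∑ j, ∑ s, (xt1 j s - xt j s) ^ 2
          ≤ bL A b c xt lam ρ - bL A b c xt1 lam ρ) := by
  have hfirst : (1 / (2 * τ) - κ / 2) * ∑ j, ∑ s, (xt1 j s - xt j s) ^ 2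
      ≤ bL A b c xt lam ρ - bL A b c xt1 lam ρ := by
    let z : ℕ → ∀ l, Fin (nn l) → ℝ := fun k l => if l.val < k then xt1 l else xt l
    have hstep (j : Fin p) : (1 / (2 * τ) - κ / 2) * ∑ s, (xt1 j s - xt j s) ^ 2
        ≤ bL A b c (z j) lam ρ - bL A b c (z (j + 1)) lam ρ := by
      have hz : z (j + 1) = Function.update (z j) j (xt1 j) := by
        funext l
        rcases eq_or_ne l j with rfl | hl
        · simp [z]
        · have hlt : l.val < j.val + 1 ↔ l.val < j.val := by
            have := Fin.val_ne_of_ne hl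
            omega
          simp only [z, Function.update_of_ne hl, hlt]
      have hzj : z j j = xt j := by simp [z]
      have hdesc := bL_update_le A b c lam hρ.le (z j) j (xt1 j)
      have hgj : c j + (A j)ᵀ *ᵥ lam + ρ • (A j)ᵀ *ᵥ posv ((∑ l, A l *ᵥ z j l) - b) = g j := by
        rw [hg j]
        rfl
      rw [← hz, hgj, hzj] at hdesc
      have hmin := (hupd j).2 (xt j) (hxt j)
      have hnorm := mul_le_mul_of_nonneg_left (sum_block_mulVec_sq_le A j (xt1 j - xt j)) hρ.le
      have hdot : (fun s => xt j s - xt j s) ⬝ᵥ g j = 0 := by simp [dotProduct]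
      have hsub : (fun s => xt1 j s - xt j s) = xt1 j - xt j := rfl
      have hzero : ∑ s, (xt j s - xt j s) ^ 2 = 0 := by simp
      rw [hdot, hzero, hsub] at hmin
      simp only [Pi.sub_apply, ← mul_assoc, ← hκ] at hnorm
      linarith
    have hsum := Finset.sum_le_sum fun j (_ : j ∈ Finset.univ) => hstep j
    rw [← Finset.mul_sum, Fin.sum_univ_eq_sum_range
      (fun k => bL A b c (z k) lam ρ - bL A b c (z (k + 1)) lam ρ), Finset.sum_range_sub'] at hsum
    have h0 : z 0 = xt := by simp [z]
    have hp : z p = xt1 := by simp [z]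
    rwa [h0, hp] at hsum
  refine ⟨hfirst, fun hlt => le_trans ?_ hfirst⟩
  refine mul_le_mul_of_nonneg_right ?_
    (Finset.sum_nonneg fun j _ => Finset.sum_nonneg fun s _ => sq_nonneg _)
  have hκ2 : 0 < 2 * κ := one_div_pos.1 (hτ.trans hlt)
  have : κ < 1 / (2 * τ) := by
    rw [lt_div_iff₀ hκ2] at hlt
    rw [lt_div_iff₀ (by positivity)]
    linarith
  linarith
end

section
/- (Too-small step sizes produce fixed points.) Let X ⊆ {0,1}ⁿ be nonempty, x^t ∈ X, and g ∈ ℝⁿ with g ≠ 0. If 0 < τ < 1/(2‖g‖), then x^t minimizes the linear function u ↦ (τg + (1/2)·1 − x^t)ᵀ u over u ∈ X; that is, (τg + (1/2)·1 − x^t)ᵀ x^t ≤ (τg + (1/2)·1 − x^t)ᵀ x for all x ∈ X. -/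
open Matrix

/-- Euclidean norm of a vector in `ℝᵏ`. -/
noncomputable def l2norm {k : ℕ} (v : Fin k → ℝ) : ℝ := Real.sqrt (∑ i, v i ^ 2)

theorem abs_le_l2norm {k : ℕ} (v : Fin k → ℝ) (i : Fin k) : |v i| ≤ l2norm v :=
  Real.abs_le_sqrt (Finset.single_le_sum (f := fun j => v j ^ 2)
    (fun j _ => sq_nonneg (v j)) (Finset.mem_univ i))

/-- too-small step sizes produce fixed points.
Let `X ⊆ {0,1}ⁿ` be nonempty, `xᵗ ∈ X` and `g ≠ 0`.  If `0 < τ < 1/(2‖g‖)`, then `xᵗ`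
minimizes the linear function `u ↦ (τg + ½·1 − xᵗ)ᵀu` over `X`. -/
theorem small_step_fixed_point {n : ℕ} (X : Set (Fin n → ℝ))
    (hXne : X.Nonempty) (hXbin : ∀ x ∈ X, ∀ i, x i = 0 ∨ x i = 1)
    (xt : Fin n → ℝ) (hxt : xt ∈ X)
    (g : Fin n → ℝ) (hg : g ≠ 0)
    (τ : ℝ) (hτ0 : 0 < τ) (hτ : τ < 1 / (2 * l2norm g)) :
    ∀ x ∈ X,
      (fun i => τ * g i + 1 / 2 - xt i) ⬝ᵥ xt
        ≤ (fun i => τ * g i + 1 / 2 - xt i) ⬝ᵥ x := by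
  intro x hx
  have hpos : 0 < 2 * l2norm g := one_div_pos.mp (hτ0.trans hτ)
  have hτg : τ * l2norm g ≤ 1 / 2 := by
    have := (lt_div_iff₀ hpos).mp hτ
    linarith
  refine Finset.sum_le_sum fun i _ => ?_
  have hi : |τ * g i| ≤ 1 / 2 := by
    rw [abs_mul, abs_of_pos hτ0]
    exact (mul_le_mul_of_nonneg_left (abs_le_l2norm g i) hτ0.le).trans hτg
  obtain ⟨hlower, hupper⟩ := abs_le.mp hi
  rcases hXbin xt hxt i with h | h <;> rcases hXbin x hx i with h' | h' <;>
    simp only [h, h'] <;> linarith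
end

section
/- (Minimizers are τ-stationary points.) Let λ ∈ ℝ₊ᵐ, ρ > 0, κ = ρ‖A‖₂² > 0, and let x* ∈ X minimize L(·,λ,ρ) over X. Then for every step size τ with 0 < τ < 1/κ, x* is a τ-stationary point: (τ∇L(x*,λ,ρ) + (1/2)·1 − x*)ᵀ x* ≤ (τ∇L(x*,λ,ρ) + (1/2)·1 − x*)ᵀ x for all x ∈ X. -/
open Matrix

/-- The gradient in `x` of the augmented Lagrangian:
`∇L(x,λ,ρ) = c + Aᵀλ + ρ·Aᵀ(Ax − b)₊`. -/
noncomputable def gradL {m n : ℕ} (A : Matrix (Fin m) (Fin n) ℝ) (b : Fin m → ℝ)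
    (c : Fin n → ℝ) (lam : Fin m → ℝ) (ρ : ℝ) (x : Fin n → ℝ) : Fin n → ℝ :=
  fun j => c j + Aᵀ.mulVec lam j + ρ * Aᵀ.mulVec (posv (A.mulVec x - b)) j

/-- The squared positive part has a quadratic upper bound with unit curvature. -/
theorem sq_max_zero_add_le (s e : ℝ) :
    max (s + e) 0 ^ 2 ≤ max s 0 ^ 2 + 2 * max s 0 * e + e ^ 2 := by
  rcases max_cases (s + e) 0 with ⟨h, _⟩ | ⟨h, _⟩ <;>
    rcases max_cases s 0 with ⟨h', _⟩ | ⟨h', _⟩ <;> rw [h, h'] <;>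
    nlinarith [sq_nonneg (s + e)]

theorem sum_sq_mulVec_le_specNorm {m n : ℕ} (A : Matrix (Fin m) (Fin n) ℝ) (d : Fin n → ℝ) :
    ∑ i, A.mulVec d i ^ 2 ≤ specNorm A ^ 2 * ∑ j, d j ^ 2 := by
  have h := (LinearMap.toContinuousLinearMap (Matrix.toEuclideanLin A)).le_opNorm
    (WithLp.toLp 2 d)
  have h2 := pow_le_pow_left₀ (norm_nonneg _) h 2
  rw [mul_pow, EuclideanSpace.real_norm_sq_eq, EuclideanSpace.real_norm_sq_eq] at h2
  simpa [specNorm, Matrix.toLpLin_apply] using h2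

theorem gradL_dotProduct {m n : ℕ} (A : Matrix (Fin m) (Fin n) ℝ) (b : Fin m → ℝ)
    (c : Fin n → ℝ) (lam : Fin m → ℝ) (ρ : ℝ) (x d : Fin n → ℝ) :
    gradL A b c lam ρ x ⬝ᵥ d =
      c ⬝ᵥ d + lam ⬝ᵥ A.mulVec d + ρ * (posv (A.mulVec x - b) ⬝ᵥ A.mulVec d) := by
  have h : gradL A b c lam ρ x =
      c + Aᵀ.mulVec lam + ρ • Aᵀ.mulVec (posv (A.mulVec x - b)) := rfl
  rw [h, add_dotProduct, add_dotProduct, smul_dotProduct, mulVec_transpose, mulVec_transpose,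
    ← dotProduct_mulVec, ← dotProduct_mulVec, smul_eq_mul]

/-- Descent lemma for the augmented Lagrangian. -/
theorem aL_add_le {m n : ℕ} (A : Matrix (Fin m) (Fin n) ℝ) (b : Fin m → ℝ)
    (c : Fin n → ℝ) (lam : Fin m → ℝ) {ρ : ℝ} (hρ : 0 ≤ ρ) (x d : Fin n → ℝ) :
    aL A b c (x + d) lam ρ ≤ aL A b c x lam ρ + gradL A b c lam ρ x ⬝ᵥ d +
      ρ * specNorm A ^ 2 / 2 * ∑ j, d j ^ 2 := by
  have hpos : ∑ i, posv (A.mulVec (x + d) - b) i ^ 2 ≤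
      ∑ i, posv (A.mulVec x - b) i ^ 2 + 2 * (posv (A.mulVec x - b) ⬝ᵥ A.mulVec d) +
        ∑ i, A.mulVec d i ^ 2 := by
    rw [dotProduct, Finset.mul_sum, ← Finset.sum_add_distrib, ← Finset.sum_add_distrib]
    refine Finset.sum_le_sum fun i _ => ?_
    have h := sq_max_zero_add_le ((A.mulVec x - b) i) (A.mulVec d i)
    have e : (A.mulVec (x + d) - b) i = (A.mulVec x - b) i + A.mulVec d i := by
      rw [mulVec_add]
      simp only [Pi.sub_apply, Pi.add_apply]
      ring
    simp only [posv, e]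
    linarith
  have hle := mul_le_mul_of_nonneg_left
    (hpos.trans (add_le_add_right (sum_sq_mulVec_le_specNorm A d) _)) (div_nonneg hρ zero_le_two)
  have hlin : lam ⬝ᵥ (A.mulVec (x + d) - b) = lam ⬝ᵥ (A.mulVec x - b) + lam ⬝ᵥ A.mulVec d := by
    rw [← dotProduct_add, mulVec_add, add_sub_right_comm]
  rw [gradL_dotProduct, aL, aL, hlin, dotProduct_add]
  linarith

/-- minimizers are τ-stationary points.
Let `λ ∈ ℝ₊ᵐ`, `ρ > 0`, `κ = ρ‖A‖₂² > 0`, and let `x* ∈ X` minimize `L(·,λ,ρ)` over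
`X`.  Then for every `0 < τ < 1/κ`, `x*` is a `τ`-stationary point:
`(τ∇L(x*) + ½·1 − x*)ᵀx* ≤ (τ∇L(x*) + ½·1 − x*)ᵀx` for all `x ∈ X`. -/
theorem minimizer_is_tau_stationary {m n : ℕ} (A : Matrix (Fin m) (Fin n) ℝ)
    (b : Fin m → ℝ) (c : Fin n → ℝ) (X : Set (Fin n → ℝ))
    (hXfin : X.Finite) (hXne : X.Nonempty)
    (hXbin : ∀ x ∈ X, ∀ i, x i = 0 ∨ x i = 1)
    (lam : Fin m → ℝ) (hlam : ∀ i, 0 ≤ lam i) (ρ : ℝ) (hρ : 0 < ρ)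
    (κ : ℝ) (hκ : κ = ρ * specNorm A ^ 2) (hκpos : 0 < κ)
    (xstar : Fin n → ℝ) (hxstarX : xstar ∈ X)
    (hxstarmin : ∀ x ∈ X, aL A b c xstar lam ρ ≤ aL A b c x lam ρ) :
    ∀ τ : ℝ, 0 < τ → τ < 1 / κ →
      ∀ x ∈ X,
        (fun j => τ * gradL A b c lam ρ xstar j + 1 / 2 - xstar j) ⬝ᵥ xstar
          ≤ (fun j => τ * gradL A b c lam ρ xstar j + 1 / 2 - xstar j) ⬝ᵥ x := by
  intro τ hτ hτκ x hx
  have hdesc := aL_add_le A b c lam hρ.le xstar (x - xstar)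
  rw [add_sub_cancel, ← hκ] at hdesc
  have hgrad : 0 ≤ gradL A b c lam ρ xstar ⬝ᵥ (x - xstar) +
      κ / 2 * ∑ j, (x - xstar) j ^ 2 := by
    linarith [hxstarmin x hx]
  have hτκ' : τ * κ < 1 := (lt_div_iff₀ hκpos).mp hτκ
  have hsq : 0 ≤ ∑ j, (x - xstar) j ^ 2 := Finset.sum_nonneg fun j _ => sq_nonneg _
  have hbin : (fun j => τ * gradL A b c lam ρ xstar j + 1 / 2 - xstar j) ⬝ᵥ (x - xstar) =
      τ * (gradL A b c lam ρ xstar ⬝ᵥ (x - xstar)) + 1 / 2 * ∑ j, (x - xstar) j ^ 2 := by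
    simp only [dotProduct, Finset.mul_sum]
    rw [← Finset.sum_add_distrib]
    refine Finset.sum_congr rfl fun j _ => ?_
    rw [Pi.sub_apply]
    rcases hXbin x hx j with h | h <;> rcases hXbin xstar hxstarX j with h' | h' <;>
      rw [h, h'] <;> ring
  rw [← sub_nonneg, ← dotProduct_sub, hbin]
  nlinarith [mul_nonneg hτ.le hgrad, mul_nonneg (sub_nonneg.mpr hτκ'.le) hsq]
end

section
/- (Finite termination bound for sufficiently decreasing sequences.) Let λ ∈ ℝ₊ᵐ, ρ > 0, κ = ρ‖A‖₂² > 0, and C = max_{x∈X} ‖∇L(x,λ,ρ)‖. Then: (a) for all x, x* ∈ X, L(x,λ,ρ) − L(x*,λ,ρ) ≤ C·√n + κ·n/2; and (b) any finite sequence x⁰, x¹, …, x^T in X satisfying L(x^{t+1},λ,ρ) ≤ L(x^t,λ,ρ) − κ/2 for all 0 ≤ t < T must have T ≤ (2C√n + κn)/κ. -/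
open Matrix

theorem posv_sq_le (r s : ℝ) :
    max s 0 ^ 2 ≤ max r 0 ^ 2 + 2 * (max r 0 * (s - r)) + (s - r) ^ 2 := by
  rcases max_cases r 0 with ⟨hr, _⟩ | ⟨hr, _⟩ <;> rcases max_cases s 0 with ⟨hs, _⟩ | ⟨hs, _⟩ <;>
    rw [hr, hs] <;> nlinarith

theorem sum_sq_mulVec_le {m n : ℕ} (A : Matrix (Fin m) (Fin n) ℝ) (d : Fin n → ℝ) :
    ∑ i, (A.mulVec d) i ^ 2 ≤ specNorm A ^ 2 * ∑ j, d j ^ 2 := by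
  have h := (LinearMap.toContinuousLinearMap (Matrix.toEuclideanLin A)).le_opNorm
    (WithLp.toLp 2 d)
  have h2 := pow_le_pow_left₀ (norm_nonneg _) h 2
  rw [mul_pow, EuclideanSpace.real_norm_sq_eq, EuclideanSpace.real_norm_sq_eq] at h2
  exact h2

/-- The descent inequality for the augmented Lagrangian. -/
theorem aL_descent {m n : ℕ} (A : Matrix (Fin m) (Fin n) ℝ) (b : Fin m → ℝ) (c : Fin n → ℝ)
    (lam : Fin m → ℝ) {ρ : ℝ} (hρ : 0 ≤ ρ) (x y : Fin n → ℝ) :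
    aL A b c y lam ρ ≤ aL A b c x lam ρ + (y - x) ⬝ᵥ gradL A b c lam ρ x
      + ρ * specNorm A ^ 2 / 2 * ∑ j, (y - x) j ^ 2 := by
  have transpose_dot (v : Fin m → ℝ) : (y - x) ⬝ᵥ Aᵀ.mulVec v = v ⬝ᵥ A.mulVec (y - x) := by
    rw [Matrix.mulVec_transpose, dotProduct_comm, Matrix.dotProduct_mulVec]
  have hgrad : gradL A b c lam ρ x
      = c + Aᵀ.mulVec lam + ρ • Aᵀ.mulVec (posv (A.mulVec x - b)) := rfl
  have hinner : (y - x) ⬝ᵥ gradL A b c lam ρ x = c ⬝ᵥ (y - x) + lam ⬝ᵥ A.mulVec (y - x)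
      + ρ * (posv (A.mulVec x - b) ⬝ᵥ A.mulVec (y - x)) := by
    rw [hgrad, dotProduct_add, dotProduct_add, dotProduct_smul, transpose_dot, transpose_dot,
      dotProduct_comm, smul_eq_mul]
  have hpos : ∑ i, posv (A.mulVec y - b) i ^ 2 ≤ ∑ i, posv (A.mulVec x - b) i ^ 2
      + 2 * (posv (A.mulVec x - b) ⬝ᵥ A.mulVec (y - x)) + ∑ i, A.mulVec (y - x) i ^ 2 := by
    rw [dotProduct, Finset.mul_sum, ← Finset.sum_add_distrib, ← Finset.sum_add_distrib]
    refine Finset.sum_le_sum fun i _ => ?_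
    have h := posv_sq_le ((A.mulVec x - b) i) ((A.mulVec y - b) i)
    have hd : (A.mulVec y - b) i - (A.mulVec x - b) i = A.mulVec (y - x) i := by
      simp [Matrix.mulVec_sub]
    rwa [hd] at h
  have hscaled := mul_le_mul_of_nonneg_left
    (hpos.trans (add_le_add_right (sum_sq_mulVec_le A (y - x)) _)) (div_nonneg hρ zero_le_two)
  rw [hinner]
  simp only [aL, Matrix.mulVec_sub, dotProduct_sub] at hscaled ⊢
  linarith

theorem dotProduct_le_l2norm_mul {k : ℕ} (v w : Fin k → ℝ) : v ⬝ᵥ w ≤ l2norm v * l2norm w :=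
  Real.sum_mul_le_sqrt_mul_sqrt _ _ _

theorem sum_sq_sub_le_of_binary {n : ℕ} {x y : Fin n → ℝ} (hx : ∀ i, x i = 0 ∨ x i = 1)
    (hy : ∀ i, y i = 0 ∨ y i = 1) : ∑ i, (x - y) i ^ 2 ≤ n := by
  calc ∑ i, (x - y) i ^ 2 ≤ ∑ _i : Fin n, (1 : ℝ) := by
        refine Finset.sum_le_sum fun i _ => ?_
        rcases hx i with h | h <;> rcases hy i with h' | h' <;> simp [h, h']
    _ = n := by simp

/-- finite termination bound for sufficiently decreasing sequences.
With `κ = ρ‖A‖₂² > 0` and `C = max_{x∈X} ‖∇L(x,λ,ρ)‖`: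
(a) for all `x, x* ∈ X`, `L(x,λ,ρ) − L(x*,λ,ρ) ≤ C√n + κn/2`; and
(b) any finite sequence `x⁰,…,x^T` in `X` with `L(x^{t+1}) ≤ L(x^t) − κ/2` for all
`0 ≤ t < T` has `T ≤ (2C√n + κn)/κ`. -/
theorem finite_termination_bound {m n : ℕ} (A : Matrix (Fin m) (Fin n) ℝ)
    (b : Fin m → ℝ) (c : Fin n → ℝ) (X : Set (Fin n → ℝ))
    (hXfin : X.Finite) (hXne : X.Nonempty)
    (hXbin : ∀ x ∈ X, ∀ i, x i = 0 ∨ x i = 1)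
    (lam : Fin m → ℝ) (hlam : ∀ i, 0 ≤ lam i) (ρ : ℝ) (hρ : 0 < ρ)
    (κ : ℝ) (hκ : κ = ρ * specNorm A ^ 2) (hκpos : 0 < κ)
    (C : ℝ) (hC : IsGreatest ((fun x => l2norm (gradL A b c lam ρ x)) '' X) C) :
    (∀ x ∈ X, ∀ xstar ∈ X,
        aL A b c x lam ρ - aL A b c xstar lam ρ ≤ C * Real.sqrt n + κ * n / 2)
    ∧ (∀ (T : ℕ) (x : ℕ → Fin n → ℝ),
        (∀ t ≤ T, x t ∈ X) →
        (∀ t < T, aL A b c (x (t + 1)) lam ρ ≤ aL A b c (x t) lam ρ - κ / 2) →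
        (T : ℝ) ≤ (2 * C * Real.sqrt n + κ * n) / κ) := by
  have gap : ∀ x ∈ X, ∀ xstar ∈ X,
      aL A b c x lam ρ - aL A b c xstar lam ρ ≤ C * Real.sqrt n + κ * n / 2 := by
    intro x hx xstar hxs
    have hdist := sum_sq_sub_le_of_binary (hXbin x hx) (hXbin xstar hxs)
    have hgradC : l2norm (gradL A b c lam ρ xstar) ≤ C := hC.2 ⟨xstar, hxs, rfl⟩
    have hinner : (x - xstar) ⬝ᵥ gradL A b c lam ρ xstar ≤ Real.sqrt n * C :=
      (dotProduct_le_l2norm_mul _ _).trans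
        (mul_le_mul (Real.sqrt_le_sqrt hdist) hgradC (Real.sqrt_nonneg _) (Real.sqrt_nonneg _))
    have hdescent := aL_descent A b c lam hρ.le xstar x
    rw [← hκ] at hdescent
    have hquad := mul_le_mul_of_nonneg_left hdist (half_pos hκpos).le
    linarith
  refine ⟨gap, fun T x hxX hdec => ?_⟩
  have hsum : ∀ t ≤ T, aL A b c (x t) lam ρ ≤ aL A b c (x 0) lam ρ - t * (κ / 2) := by
    intro t
    induction t with
    | zero => simp
    | succ t ih =>
      intro ht
      have h1 := ih (by omega)
      have h2 := hdec t (by omega)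
      push_cast
      linarith
  have hT := hsum T le_rfl
  have hgap := gap (x 0) (hxX 0 (Nat.zero_le T)) (x T) (hxX T le_rfl)
  rw [le_div_iff₀ hκpos]
  linarith
end
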